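/- Let χ be a primitive Dirichlet character (mod n), let F be an arbitrary arithmetic function F : ℕ → ℂ, and let s be an integer. Then Σ_{k=1}^{n} F(gcd(k − s, n)) χ(k) = (μ∗F)(n) · χ(s). -/

import Mathlib

open Finset ArithmeticFunction

/-- The integers `1, …, n` form a complete residue system modulo `n`. -/
theorem ZMod.sum_Icc_natCast {M : Type*} [AddCommMonoid M] (n : ℕ) [NeZero n] (f : ZMod n → M) :
    ∑ k ∈ Icc 1 n, f (k : ZMod n) = ∑ x, f x := by
  have hn : 0 < n := Nat.pos_of_neZero n
  refine sum_bij (fun k _ => (k : ZMod n)) (by simp) ?_ ?_ (fun _ _ => rfl)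
  · intro a ha b hb hab
    rw [mem_Icc] at ha hb
    have hdvd : (n : ℤ) ∣ (b : ℤ) - a :=
      Nat.modEq_iff_dvd.mp ((ZMod.natCast_eq_natCast_iff a b n).mp hab)
    have := Int.eq_zero_of_abs_lt_dvd hdvd (by rw [abs_lt]; omega)
    omega
  · intro x _
    by_cases hx : x = 0
    · exact ⟨n, mem_Icc.mpr ⟨hn, le_rfl⟩, by simp [hx]⟩
    · exact ⟨x.val, mem_Icc.mpr ⟨Nat.pos_of_ne_zero ((ZMod.val_ne_zero x).mpr hx), x.val_lt.le⟩,
        by simp⟩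

/-- The values of a Dirichlet character over a residue class modulo `d` sum to zero unless the
character factors through `d`. -/
theorem DirichletCharacter.sum_castHom_eq_zero {R : Type*} [CommRing R] [IsDomain R] {n d : ℕ}
    [NeZero n] {χ : DirichletCharacter R n} (hd : d ∣ n) (hχ : ¬ χ.FactorsThrough d)
    (c : ZMod d) [DecidablePred fun x : ZMod n => ZMod.castHom hd (ZMod d) x = c] :
    ∑ x : ZMod n with ZMod.castHom hd (ZMod d) x = c, χ x = 0 := by
  rw [factorsThrough_iff_ker_unitsMap hd, SetLike.not_le_iff_exists] at hχ
  obtain ⟨u, hu, hχu⟩ := hχ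
  rw [MonoidHom.mem_ker] at hu hχu
  have hu' : ZMod.castHom hd (ZMod d) (u : ZMod n) = 1 := by
    simpa [ZMod.unitsMap_def] using congrArg Units.val hu
  have hχu' : χ (u : ZMod n) ≠ 1 := fun h => hχu (Units.ext (by simpa using h))
  refine eq_zero_of_mul_eq_self_left hχu' ?_
  rw [mul_sum, sum_filter, sum_filter]
  refine Fintype.sum_equiv u.mulLeft _ _ fun x => ?_
  simp only [Units.mulLeft_apply, map_mul, hu', one_mul]

/-- Let `χ` be a primitive Dirichlet character (mod `n`), let `F : ℕ → ℂ` be an arbitrary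
arithmetic function, and let `s` be an integer.  Then
`∑_{k=1}^{n} F (gcd (k - s) n) χ(k) = (μ∗F)(n) · χ(s)`. -/
theorem menon_primitive_character_arith (n : ℕ) (hn : 0 < n)
    (χ : DirichletCharacter ℂ n) (hprim : χ.IsPrimitive) (F : ℕ → ℂ) (s : ℤ) :
    ∑ k ∈ Finset.Icc 1 n, F (Int.gcd ((k : ℤ) - s) (n : ℤ)) * χ (k : ZMod n)
      = (∑ a ∈ n.divisors, (moebius a : ℂ) * F (n / a)) * χ ((s : ℤ) : ZMod n) := by
  classical
  have : NeZero n := ⟨hn.ne'⟩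
  let G : ℕ → ℂ := fun m => ∑ a ∈ m.divisors, (moebius a : ℂ) * F (m / a)
  have hG : ∀ m > 0, ∑ d ∈ m.divisors, G d = F m :=
    sum_eq_iff_sum_mul_moebius_eq.mpr fun m _ =>
      Nat.sum_divisorsAntidiagonal fun a b => (moebius a : ℂ) * F b
  have hF (k : ℕ) : F (Int.gcd ((k : ℤ) - s) n) =
      ∑ d ∈ n.divisors, if (d : ℤ) ∣ (k : ℤ) - s then G d else 0 := by
    have hgcd : 0 < Int.gcd ((k : ℤ) - s) n :=
      Int.gcd_pos_of_ne_zero_right _ (by exact_mod_cast hn.ne')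
    rw [← hG _ hgcd, ← sum_filter]
    refine sum_congr (Finset.ext fun d => ?_) fun _ _ => rfl
    simp only [Nat.mem_divisors, mem_filter, Int.dvd_gcd_iff, Int.natCast_dvd_natCast]
    have := hgcd.ne'
    have := hn.ne'
    tauto
  have hclass (d : ℕ) (hd : d ∣ n) :
      ∑ k ∈ Icc 1 n, (if (d : ℤ) ∣ (k : ℤ) - s then χ (k : ZMod n) else 0) =
        ∑ x : ZMod n with ZMod.castHom hd (ZMod d) x = (s : ZMod d), χ x := by
    rw [sum_filter, ← ZMod.sum_Icc_natCast]
    refine sum_congr rfl fun k _ => if_congr ?_ rfl rfl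
    rw [← ZMod.intCast_zmod_eq_zero_iff_dvd]
    simp [sub_eq_zero]
  calc
    _ = ∑ d ∈ n.divisors, G d *
        ∑ k ∈ Icc 1 n, (if (d : ℤ) ∣ (k : ℤ) - s then χ (k : ZMod n) else 0) := by
      simp_rw [hF, sum_mul, mul_sum]
      rw [sum_comm]
      simp only [ite_mul, mul_ite, zero_mul, mul_zero]
    _ = G n * ∑ k ∈ Icc 1 n, (if (n : ℤ) ∣ (k : ℤ) - s then χ (k : ZMod n) else 0) := by
      refine sum_eq_single_of_mem n (Nat.mem_divisors_self n hn.ne') fun d hd hdn => ?_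
      have hdvd := Nat.dvd_of_mem_divisors hd
      rw [hclass d hdvd, DirichletCharacter.sum_castHom_eq_zero hdvd, mul_zero]
      intro hχ
      have hle : χ.conductor ≤ d := Nat.sInf_le hχ
      rw [hprim] at hle
      exact hdn (le_antisymm (Nat.le_of_dvd hn hdvd) hle)
    _ = G n * χ (s : ZMod n) := by
      rw [hclass n dvd_rfl]
      simp [sum_filter]
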